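/- arXiv:2605.21761 — 2 statements merged into one kernel-verified Lean document; each statement's English description precedes it below -/
import Mathlib

section
/- Let φ be a circle covering map of degree two of class C² with positive derivative, not topologically conjugate to the doubling map, such that the collection of all maximal periodic intervals of φ is finite and nonempty, say I₁,…,I_r, and set Λ := 𝕊¹ \ ⋃_{n≥0} φ^{-n}(I₁ ∪ ⋯ ∪ I_r). Let x₀ ∈ Λ be a fixed point of φ with (x₀, x₀+ε) ∩ Λ ≠ ∅ for every ε > 0, let B₀ be a nice interval whose left endpoint is x₀, and for n ≥ 1 let Bₙ be the connected component of φ^{-1}(B_{n-1}) containing x₀. Then each Bₙ is a nice interval, |Bₙ| → 0 as n → ∞, and moreover εₙ := sup{ |J| : J is a connected component of φ^{-i}(Bₙ) for some i ≥ 0 } → 0 as n → ∞. -/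
open Set Filter MeasureTheory Topology

noncomputable section

/-- `F : ℝ → ℝ` is a lift of `φ : 𝕊¹ → 𝕊¹` witnessing that `φ` is a
circle covering map of degree two. -/
def IsLiftDeg2 (φ : UnitAddCircle → UnitAddCircle) (F : ℝ → ℝ) : Prop :=
  Continuous F ∧ StrictMono F ∧ (∀ x : ℝ, F (x + 1) = F x + 2) ∧
    ∀ x : ℝ, φ (x : UnitAddCircle) = ((F x : ℝ) : UnitAddCircle)

/-- The closed arc on the circle starting at `a` (counterclockwise) of length `ℓ`. -/
def closedArc (a ℓ : ℝ) : Set UnitAddCircle :=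
  (fun t : ℝ => (t : UnitAddCircle)) '' Set.Icc a (a + ℓ)

/-- The open arc on the circle starting at `a` (counterclockwise) of length `ℓ`. -/
def openArc (a ℓ : ℝ) : Set UnitAddCircle :=
  (fun t : ℝ => (t : UnitAddCircle)) '' Set.Ioo a (a + ℓ)

/-- The open arc `(x, x + ε)` counterclockwise. -/
def rightArc (x : UnitAddCircle) (ε : ℝ) : Set UnitAddCircle :=
  {y | ∃ t : ℝ, 0 < t ∧ t < ε ∧ y = x + (t : UnitAddCircle)}

/-- The open arc `(x - ε, x)` counterclockwise. -/
def leftArc (x : UnitAddCircle) (ε : ℝ) : Set UnitAddCircle :=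
  {y | ∃ t : ℝ, 0 < t ∧ t < ε ∧ y = x - (t : UnitAddCircle)}

/-- `I` is a periodic interval of `φ` of period `s`: a proper nondegenerate closed arc
mapped onto itself homeomorphically by `φ^s`. -/
def IsPeriodicInterval (φ : UnitAddCircle → UnitAddCircle) (s : ℕ)
    (I : Set UnitAddCircle) : Prop :=
  1 ≤ s ∧ (∃ a ℓ : ℝ, 0 < ℓ ∧ ℓ < 1 ∧ I = closedArc a ℓ) ∧ Set.BijOn (φ^[s]) I I

/-- A maximal periodic interval of `φ`. -/
def IsMaxPeriodicInterval (φ : UnitAddCircle → UnitAddCircle)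
    (I : Set UnitAddCircle) : Prop :=
  (∃ s, IsPeriodicInterval φ s I) ∧ ∀ J, (∃ s, IsPeriodicInterval φ s J) → I ⊆ J → I = J

/-- `Λ = 𝕊¹ \ ⋃ₙ φ⁻ⁿ(I₁ ∪ ⋯ ∪ I_r)`, the complement of all preimages of the
maximal periodic intervals. -/
def lambdaSet (φ : UnitAddCircle → UnitAddCircle) : Set UnitAddCircle :=
  Set.univ \ ⋃ n : ℕ, (φ^[n]) ⁻¹' (⋃ I ∈ {I | IsMaxPeriodicInterval φ I}, I)

/-- The doubling map `x ↦ 2x (mod 1)`. -/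
def doubling : UnitAddCircle → UnitAddCircle := fun x => x + x

/-- `φ` is topologically conjugate to the doubling map. -/
def ConjugateToDoubling (φ : UnitAddCircle → UnitAddCircle) : Prop :=
  ∃ h : UnitAddCircle ≃ₜ UnitAddCircle, ∀ x, h (φ x) = doubling (h x)

/-- `I` is a `φ`-dyadic interval of degree `n` (described via the lift `F` of `φ`):
a closed arc whose endpoints are consecutive `φⁿ`-preimages of `0`. -/
def IsDyadic (F : ℝ → ℝ) (n : ℕ) (I : Set UnitAddCircle) : Prop :=
  ∃ a b : ℝ, a < b ∧ (∃ k : ℤ, F^[n] a = (k : ℝ)) ∧ F^[n] b = F^[n] a + 1 ∧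
    I = (fun t : ℝ => (t : UnitAddCircle)) '' Set.Icc a b

/-- `G` is a lift of the orientation-preserving circle homeomorphism `g`. -/
def IsOPLift (g : UnitAddCircle → UnitAddCircle) (G : ℝ → ℝ) : Prop :=
  Continuous G ∧ StrictMono G ∧ (∀ x : ℝ, G (x + 1) = G x + 1) ∧
    ∀ x : ℝ, g (x : UnitAddCircle) = ((G x : ℝ) : UnitAddCircle)

/-- `g` belongs to the Ghys–Sergiescu Thompson group `T_φ` (with `F` a lift of `φ`):
`g` is an orientation-preserving circle homeomorphism and there are partitions of the
circle into `φ`-dyadic intervals `I k`, `J k` such that `g` maps `I k` onto `J k` and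
`g = φ_{J k}⁻¹ ∘ φ_{I k}` on `I k`, i.e. `φ^[m k] ∘ g = φ^[n k]` on `I k`. -/
def InThompsonGroup (φ : UnitAddCircle → UnitAddCircle) (F : ℝ → ℝ)
    (g : UnitAddCircle → UnitAddCircle) : Prop :=
  (∃ G : ℝ → ℝ, IsOPLift g G) ∧
  ∃ (r : ℕ) (I J : Fin r → Set UnitAddCircle) (n m : Fin r → ℕ),
    0 < r ∧
    (∀ k, IsDyadic F (n k) (I k)) ∧ (∀ k, IsDyadic F (m k) (J k)) ∧
    (⋃ k, I k) = Set.univ ∧ (⋃ k, J k) = Set.univ ∧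
    (Pairwise fun k l => interior (I k) ∩ interior (I l) = ∅) ∧
    (Pairwise fun k l => interior (J k) ∩ interior (J l) = ∅) ∧
    (∀ k, g '' I k = J k) ∧ (∀ k, ∀ x ∈ I k, φ^[m k] (g x) = φ^[n k] x)

/-- `x` is a nonexpandable point for the action of `T_φ`: `g′(x) ≤ 1` for every
`g ∈ T_φ` (derivatives are computed via lifts). -/
def NonExpandable (φ : UnitAddCircle → UnitAddCircle) (F : ℝ → ℝ)
    (x : UnitAddCircle) : Prop :=
  ∀ g G, InThompsonGroup φ F g → IsOPLift g G →
    ∀ x' : ℝ, (x' : UnitAddCircle) = x → deriv G x' ≤ 1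

/-- `I` is nice for `φ`: no forward iterate of the boundary returns to the interior. -/
def IsNice (φ : UnitAddCircle → UnitAddCircle) (I : Set UnitAddCircle) : Prop :=
  ∀ n : ℕ, 1 ≤ n → (φ^[n]) '' (frontier I) ∩ interior I = ∅

/-- A nice interval: a proper nondegenerate closed arc that is nice. -/
def IsNiceInterval (φ : UnitAddCircle → UnitAddCircle) (I : Set UnitAddCircle) : Prop :=
  (∃ a ℓ : ℝ, 0 < ℓ ∧ ℓ < 1 ∧ I = closedArc a ℓ) ∧ IsNice φ I

/-- `J` is a connected component of `S`. -/
def IsComponentOf (J S : Set UnitAddCircle) : Prop :=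
  ∃ x ∈ S, J = connectedComponentIn S x

/-- The set of left endpoints of connected components of `𝕊¹ \ Λ`. -/
def leftEndpoints (Λ : Set UnitAddCircle) : Set UnitAddCircle :=
  {z | ∃ C : Set UnitAddCircle, IsComponentOf C (Set.univ \ Λ) ∧
    ∃ a ℓ : ℝ, 0 < ℓ ∧ ℓ ≤ 1 ∧ C = openArc a ℓ ∧ z = (a : UnitAddCircle)}

/-- The set of right endpoints of connected components of `𝕊¹ \ Λ`. -/
def rightEndpoints (Λ : Set UnitAddCircle) : Set UnitAddCircle :=
  {z | ∃ C : Set UnitAddCircle, IsComponentOf C (Set.univ \ Λ) ∧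
    ∃ a ℓ : ℝ, 0 < ℓ ∧ ℓ ≤ 1 ∧ C = openArc a ℓ ∧ z = ((a + ℓ : ℝ) : UnitAddCircle)}

/-- `x` is a parabolic periodic point of `φ`: `φ^s(x) = x` and `(φ^s)′(x) = 1`
(the derivative computed via the lift `F`). -/
def IsParabolicPeriodicPt (φ : UnitAddCircle → UnitAddCircle) (F : ℝ → ℝ)
    (x : UnitAddCircle) : Prop :=
  ∃ s : ℕ, 1 ≤ s ∧ φ^[s] x = x ∧
    ∀ x' : ℝ, (x' : UnitAddCircle) = x → deriv (F^[s]) x' = 1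

theorem IsLiftDeg2.add_int {φ : UnitAddCircle → UnitAddCircle} {F : ℝ → ℝ}
    (hF : IsLiftDeg2 φ F) (x : ℝ) (k : ℤ) : F (x + k) = F x + 2 * k := by
  induction k with
  | zero => simp
  | succ n ih =>
    have := hF.2.2.1 (x + n)
    push_cast at ih ⊢
    rw [← add_assoc, this, ih]; ring
  | pred n ih =>
    have := hF.2.2.1 (x + (-n - 1))
    push_cast at ih ⊢
    rw [show x + (-(n : ℝ) - 1) + 1 = x + -n by ring, ih] at this
    linarith

theorem IsLiftDeg2.iterate_add_int {φ : UnitAddCircle → UnitAddCircle} {F : ℝ → ℝ}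
    (hF : IsLiftDeg2 φ F) (n : ℕ) (x : ℝ) (k : ℤ) :
    F^[n] (x + k) = F^[n] x + 2 ^ n * k := by
  induction n with
  | zero => simp
  | succ n ih =>
    have := hF.add_int (F^[n] x) (2 ^ n * k)
    push_cast at this
    rw [Function.iterate_succ_apply', Function.iterate_succ_apply', ih, this, pow_succ]
    ring

theorem IsLiftDeg2.iterate_coe {φ : UnitAddCircle → UnitAddCircle} {F : ℝ → ℝ}
    (hF : IsLiftDeg2 φ F) (n : ℕ) (x : ℝ) :
    φ^[n] (x : UnitAddCircle) = ((F^[n] x : ℝ) : UnitAddCircle) := by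
  induction n with
  | zero => simp
  | succ n ih => rw [Function.iterate_succ_apply', Function.iterate_succ_apply', ih, hF.2.2.2]

/-- Two reals have the same class on the circle iff they differ by an integer. -/
theorem coe_circle_eq_iff {x y : ℝ} :
    (x : UnitAddCircle) = (y : UnitAddCircle) ↔ ∃ k : ℤ, x = y + k := by
  rw [eq_comm, QuotientAddGroup.eq, AddSubgroup.mem_zmultiples_iff]
  simp only [zsmul_eq_mul, mul_one]
  exact exists_congr fun k => ⟨fun h => by linarith, fun h => by linarith⟩

theorem exists_abs_le_of_continuous_periodic {f : ℝ → ℝ} (hf : Continuous f)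
    (hp : Function.Periodic f 1) : ∃ M, ∀ x, |f x| ≤ M := by
  obtain ⟨M, hM⟩ := (hp.isBounded_of_continuous one_ne_zero hf).exists_norm_le
  exact ⟨M, fun x => hM _ (mem_range_self x)⟩

theorem IsLiftDeg2.exists_abs_sub_le {φ : UnitAddCircle → UnitAddCircle} {F : ℝ → ℝ}
    (hF : IsLiftDeg2 φ F) : ∃ M, ∀ x, |F x - 2 * x| ≤ M := by
  refine exists_abs_le_of_continuous_periodic (by have := hF.1; fun_prop) fun x => ?_
  rw [hF.2.2.1]; ring

theorem IsLiftDeg2.surjective {φ : UnitAddCircle → UnitAddCircle} {F : ℝ → ℝ}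
    (hF : IsLiftDeg2 φ F) : Function.Surjective F := by
  obtain ⟨M, hM⟩ := hF.exists_abs_sub_le
  refine hF.1.surjective ?_ ?_
  · refine tendsto_atTop_mono (f := fun x => 2 * x + -M) (fun x => ?_) ?_
    · linarith [(abs_le.1 (hM x)).1]
    · exact tendsto_atTop_add_const_right _ _ (tendsto_id.const_mul_atTop two_pos)
  · have hle : ∀ x, F x ≤ 2 * x + M := fun x => by linarith [(abs_le.1 (hM x)).2]
    exact tendsto_atBot_mono hle <|
      tendsto_atBot_add_const_right _ _ (tendsto_id.const_mul_atBot two_pos)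

/-- `H` is a lift of a monotone degree-one semiconjugacy from the circle map with lift `F`
to the doubling map. -/
structure IsSemiconjLift (F H : ℝ → ℝ) : Prop where
  continuous : Continuous H
  monotone : Monotone H
  add_one : ∀ x, H (x + 1) = H x + 1
  map : ∀ x, H (F x) = 2 * H x

theorem IsLiftDeg2.exists_semiconjLift {φ : UnitAddCircle → UnitAddCircle} {F : ℝ → ℝ}
    (hF : IsLiftDeg2 φ F) : ∃ H, IsSemiconjLift F H := by
  obtain ⟨M, hM⟩ := hF.exists_abs_sub_le
  have hstep : ∀ x n, |F^[n + 1] x / 2 ^ (n + 1) - F^[n] x / 2 ^ n| ≤ M / 2 / 2 ^ n := by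
    intro x n
    have : F^[n + 1] x / 2 ^ (n + 1) - F^[n] x / 2 ^ n
        = (F (F^[n] x) - 2 * F^[n] x) / 2 / 2 ^ n := by
      rw [Function.iterate_succ_apply']; field_simp; ring
    rw [this, abs_div, abs_div, abs_of_pos (by positivity : (0 : ℝ) < 2 ^ n), abs_two]
    gcongr
    exact hM _
  have hd : ∀ x n, dist (F^[n] x / 2 ^ n) (F^[n + 1] x / 2 ^ (n + 1)) ≤ M / 2 / 2 ^ n := by
    intro x n
    rw [dist_comm, Real.dist_eq]; exact hstep x n
  choose H hH using fun x => cauchySeq_tendsto_of_complete (cauchySeq_of_le_geometric_two (hd x))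
  have hdist : ∀ x n, dist (F^[n] x / 2 ^ n) (H x) ≤ M / 2 ^ n := fun x n =>
    dist_le_of_le_geometric_two_of_tendsto (hd x) (hH x) n
  refine ⟨H, ?_, ?_, ?_, ?_⟩
  · have hu : TendstoUniformly (fun n x => F^[n] x / 2 ^ n) H atTop := by
      rw [Metric.tendstoUniformly_iff]
      intro ε hε
      have : Tendsto (fun n : ℕ => M / 2 ^ n) atTop (𝓝 0) :=
        tendsto_const_nhds.div_atTop (tendsto_pow_atTop_atTop_of_one_lt one_lt_two)
      filter_upwards [this.eventually_lt_const hε] with n hn x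
      rw [dist_comm]; exact (hdist x n).trans_lt hn
    exact hu.continuous (Frequently.of_forall fun n => (hF.1.iterate n).div_const _)
  · intro x y hxy
    refine le_of_tendsto_of_tendsto' (hH x) (hH y) fun n => ?_
    gcongr
    exact hF.2.1.monotone.iterate n hxy
  · intro x
    refine tendsto_nhds_unique (hH (x + 1)) (((hH x).add_const 1).congr fun n => ?_)
    have := hF.iterate_add_int n x 1
    push_cast at this
    rw [this]; field_simp
  · intro x
    refine tendsto_nhds_unique (hH (F x))
      ((((tendsto_add_atTop_iff_nat 1).2 (hH x)).const_mul 2).congr fun n => ?_)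
    rw [Function.iterate_succ_apply, pow_succ]; field_simp

theorem volume_coe_image_Icc {a b : ℝ} (hab' : b < a + 1) :
    volume ((fun t : ℝ => (t : UnitAddCircle)) '' Icc a b) = ENNReal.ofReal (b - a) := by
  have hcl : IsClosed ((fun t : ℝ => (t : UnitAddCircle)) '' Icc a b) :=
    (isCompact_Icc.image (AddCircle.continuous_mk' 1)).isClosed
  have hmp := UnitAddCircle.measurePreserving_mk (b - 1)
  rw [← hmp.measure_preimage hcl.measurableSet.nullMeasurableSet,
    Measure.restrict_apply (hmp.measurable hcl.measurableSet), ← Real.volume_Icc]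
  congr 1
  ext t
  constructor
  · rintro ⟨⟨s, hs, hst⟩, ht⟩
    obtain ⟨k, hk⟩ := coe_circle_eq_iff.1 hst
    have h1 : (k : ℝ) < 1 := by linarith [hs.2, ht.1]
    have h2 : (-1 : ℝ) < k := by linarith [hs.1, ht.2]
    have hk0 : k = 0 := by
      have : k < 1 := by exact_mod_cast h1
      have : -1 < k := by exact_mod_cast h2
      lia
    subst hk0
    simp only [Int.cast_zero, add_zero] at hk
    exact hk ▸ hs
  · intro ht
    refine ⟨⟨t, ht, rfl⟩, ?_, ?_⟩ <;> linarith [ht.1, ht.2]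

theorem isOpen_coe_image_Ioo (a b : ℝ) :
    IsOpen ((fun t : ℝ => (t : UnitAddCircle)) '' Ioo a b) :=
  QuotientAddGroup.isOpenMap_coe _ isOpen_Ioo

theorem coe_left_notMem_interior {a b : ℝ} (hab' : b < a + 1) :
    (a : UnitAddCircle) ∉ interior ((fun t : ℝ => (t : UnitAddCircle)) '' Icc a b) := by
  intro h
  have hn : (fun t : ℝ => (t : UnitAddCircle)) ⁻¹'
      ((fun t : ℝ => (t : UnitAddCircle)) '' Icc a b) ∈ 𝓝[<] a :=
    nhdsWithin_le_nhds
      ((AddCircle.continuous_mk' 1).continuousAt.preimage_mem_nhds (mem_interior_iff_mem_nhds.1 h))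
  have hI : Ioo (b - 1) a ∈ 𝓝[<] a := Ioo_mem_nhdsLT (by linarith)
  obtain ⟨t, ⟨s, hs, hst⟩, ht⟩ := Filter.nonempty_of_mem (inter_mem hn hI)
  obtain ⟨k, hk⟩ := coe_circle_eq_iff.1 hst
  have h1 : (0 : ℝ) < k := by linarith [hs.1, ht.2]
  have h2 : (k : ℝ) < 1 := by linarith [hs.2, ht.1]
  have : 0 < k := by exact_mod_cast h1
  have : k < 1 := by exact_mod_cast h2
  lia

theorem coe_right_notMem_interior {a b : ℝ} (hab' : b < a + 1) :
    (b : UnitAddCircle) ∉ interior ((fun t : ℝ => (t : UnitAddCircle)) '' Icc a b) := by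
  intro h
  have hn : (fun t : ℝ => (t : UnitAddCircle)) ⁻¹'
      ((fun t : ℝ => (t : UnitAddCircle)) '' Icc a b) ∈ 𝓝[>] b :=
    nhdsWithin_le_nhds
      ((AddCircle.continuous_mk' 1).continuousAt.preimage_mem_nhds (mem_interior_iff_mem_nhds.1 h))
  have hI : Ioo b (a + 1) ∈ 𝓝[>] b := Ioo_mem_nhdsGT hab'
  obtain ⟨t, ⟨s, hs, hst⟩, ht⟩ := Filter.nonempty_of_mem (inter_mem hn hI)
  obtain ⟨k, hk⟩ := coe_circle_eq_iff.1 hst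
  have h1 : (k : ℝ) < 0 := by linarith [hs.2, ht.1]
  have h2 : (-1 : ℝ) < k := by linarith [hs.1, ht.2]
  have : k < 0 := by exact_mod_cast h1
  have : -1 < k := by exact_mod_cast h2
  lia

theorem frontier_coe_image_Icc {a b : ℝ} (hab : a ≤ b) (hab' : b < a + 1) :
    frontier ((fun t : ℝ => (t : UnitAddCircle)) '' Icc a b) =
      {(a : UnitAddCircle), (b : UnitAddCircle)} := by
  have hcl : IsClosed ((fun t : ℝ => (t : UnitAddCircle)) '' Icc a b) :=
    (isCompact_Icc.image (AddCircle.continuous_mk' 1)).isClosed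
  rw [hcl.frontier_eq]
  ext x
  constructor
  · rintro ⟨⟨t, ht, rfl⟩, hx⟩
    by_contra hne
    simp only [mem_insert_iff, mem_singleton_iff, not_or] at hne
    refine hx (interior_maximal (image_mono Ioo_subset_Icc_self) (isOpen_coe_image_Ioo a b)
      ⟨t, ⟨lt_of_le_of_ne ht.1 ?_, lt_of_le_of_ne ht.2 ?_⟩, rfl⟩)
    · rintro rfl; exact hne.1 rfl
    · rintro rfl; exact hne.2 rfl
  · rintro (rfl | rfl)
    · exact ⟨⟨a, left_mem_Icc.2 hab, rfl⟩, coe_left_notMem_interior hab'⟩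
    · exact ⟨⟨b, right_mem_Icc.2 hab, rfl⟩, coe_right_notMem_interior hab'⟩

/-- The components of the preimage of an arc under a circle map with monotone lift `Φ` are
the projections of the preimages under `Φ` of the lifts of the arc. -/
theorem connectedComponentIn_preimage_arc {ψ : UnitAddCircle → UnitAddCircle} {Φ : ℝ → ℝ}
    (hc : Continuous Φ) (hm : StrictMono Φ)
    (hψ : ∀ x : ℝ, ψ (x : UnitAddCircle) = ((Φ x : ℝ) : UnitAddCircle))
    {a b α β : ℝ} {k : ℤ} (hab' : b < a + 1) (hα : Φ α = a + k) (hβ : Φ β = b + k)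
    {x : ℝ} (hx : x ∈ Icc α β) :
    connectedComponentIn (ψ ⁻¹' ((fun t : ℝ => (t : UnitAddCircle)) '' Icc a b))
      (x : UnitAddCircle) = (fun t : ℝ => (t : UnitAddCircle)) '' Icc α β := by
  set S := ψ ⁻¹' ((fun t : ℝ => (t : UnitAddCircle)) '' Icc a b) with hS
  set K := (fun t : ℝ => (t : UnitAddCircle)) '' Icc α β with hK
  have hKS : K ⊆ S := by
    rintro _ ⟨y, hy, rfl⟩
    refine ⟨Φ y - k, ⟨?_, ?_⟩, ?_⟩
    · linarith [hm.monotone hy.1]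
    · linarith [hm.monotone hy.2]
    · change _ = ψ (y : UnitAddCircle)
      rw [hψ]
      exact coe_circle_eq_iff.2 ⟨-k, by push_cast; ring⟩
  have hxK : (x : UnitAddCircle) ∈ K := ⟨x, hx, rfl⟩
  apply Subset.antisymm
  · have hcl : IsClosed K := (isCompact_Icc.image (AddCircle.continuous_mk' 1)).isClosed
    set U := (fun t : ℝ => (t : UnitAddCircle)) '' (Φ ⁻¹' Ioo (b + k - 1) (a + k + 1)) with hU
    have hUo : IsOpen U := QuotientAddGroup.isOpenMap_coe _ (isOpen_Ioo.preimage hc)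
    have hKU : K ⊆ U := by
      rintro _ ⟨y, hy, rfl⟩
      refine ⟨y, ⟨?_, ?_⟩, rfl⟩
      · linarith [hm.monotone hy.1]
      · linarith [hm.monotone hy.2]
    have hUS : U ∩ S ⊆ K := by
      rintro _ ⟨⟨y, hy, rfl⟩, s, hs, hsy⟩
      change (s : UnitAddCircle) = ψ (y : UnitAddCircle) at hsy
      rw [hψ] at hsy
      obtain ⟨j, hj⟩ := coe_circle_eq_iff.1 hsy.symm
      have h1 : (j : ℝ) < k + 1 := by linarith [hs.1, hy.2]
      have h2 : (k : ℝ) < j + 1 := by linarith [hs.2, hy.1]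
      have hjk : j = k := by
        have : j < k + 1 := by exact_mod_cast h1
        have : k < j + 1 := by exact_mod_cast h2
        lia
      subst hjk
      refine ⟨y, ⟨hm.le_iff_le.1 ?_, hm.le_iff_le.1 ?_⟩, rfl⟩
      · linarith [hs.1]
      · linarith [hs.2]
    intro z hz
    by_contra hzK
    obtain ⟨w, hw, hwU, hwK⟩ := (isPreconnected_connectedComponentIn (F := S)
      (x := (x : UnitAddCircle))) U Kᶜ hUo hcl.isOpen_compl
      (fun w _ => by
        by_cases h : w ∈ K
        · exact Or.inl (hKU h)
        · exact Or.inr h)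
      ⟨_, mem_connectedComponentIn (hKS hxK), hKU hxK⟩ ⟨z, hz, hzK⟩
    exact hwK (hUS ⟨hwU, connectedComponentIn_subset _ _ hw⟩)
  · exact (isPreconnected_Icc.image _ (AddCircle.continuous_mk' 1).continuousOn)
      |>.subset_connectedComponentIn hxK hKS

theorem IsSemiconjLift.add_int {F H : ℝ → ℝ} (hH : IsSemiconjLift F H) (x : ℝ) (k : ℤ) :
    H (x + k) = H x + k := by
  induction k with
  | zero => simp
  | succ n ih =>
    have := hH.add_one (x + n)
    push_cast at ih ⊢
    rw [← add_assoc, this, ih]; ring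
  | pred n ih =>
    have := hH.add_one (x + (-n - 1))
    push_cast at ih ⊢
    rw [show x + (-(n : ℝ) - 1) + 1 = x + -n by ring, ih] at this
    linarith

theorem IsSemiconjLift.map_iterate {F H : ℝ → ℝ} (hH : IsSemiconjLift F H) (n : ℕ) (x : ℝ) :
    H (F^[n] x) = 2 ^ n * H x := by
  induction n with
  | zero => simp
  | succ n ih => rw [Function.iterate_succ_apply', hH.map, ih, pow_succ]; ring

theorem IsSemiconjLift.sub_le {F H : ℝ → ℝ} (hH : IsSemiconjLift F H) (x y : ℝ) :
    H y - H x ≤ y - x + 1 := by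
  have h1 : H y ≤ H (x + (⌈y - x⌉ : ℤ)) := hH.monotone (by linarith [Int.le_ceil (y - x)])
  rw [hH.add_int] at h1
  linarith [Int.ceil_lt_add_one (y - x)]

theorem IsSemiconjLift.lt_add_one_of_eq {F H : ℝ → ℝ} (hH : IsSemiconjLift F H) {x y : ℝ}
    (h : H x = H y) : y < x + 1 := by
  by_contra! hle
  have := hH.monotone hle
  rw [hH.add_one] at this
  linarith

theorem IsSemiconjLift.exists_fiber_eq_Icc {F H : ℝ → ℝ} (hH : IsSemiconjLift F H) (x : ℝ) :
    ∃ p q, ∀ y, H y = H x ↔ y ∈ Icc p q := by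
  set Z := H ⁻¹' {H x} with hZ
  have hne : Z.Nonempty := ⟨x, rfl⟩
  have hcl : IsClosed Z := isClosed_singleton.preimage hH.continuous
  have hbb : BddBelow Z := ⟨x - 1, fun y hy => by
    linarith [hH.lt_add_one_of_eq (x := y) (y := x) hy]⟩
  have hba : BddAbove Z := ⟨x + 1, fun y hy =>
    (hH.lt_add_one_of_eq (x := x) (y := y) (Eq.symm hy)).le⟩
  refine ⟨sInf Z, sSup Z, fun y => ⟨fun hy => ⟨csInf_le hbb hy, le_csSup hba hy⟩, fun hy => ?_⟩⟩
  have h1 : H (sInf Z) = H x := hcl.csInf_mem hne hbb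
  have h2 : H (sSup Z) = H x := hcl.csSup_mem hne hba
  exact le_antisymm (h2 ▸ hH.monotone hy.2) (h1 ▸ hH.monotone hy.1)

/-- The semiconjugacy collapses every periodic interval to a point. -/
theorem IsSemiconjLift.eq_of_mapsTo_arc {φ : UnitAddCircle → UnitAddCircle} {F H : ℝ → ℝ}
    (hF : IsLiftDeg2 φ F) (hH : IsSemiconjLift F H) {s : ℕ} (hs : 1 ≤ s) {a ℓ : ℝ}
    (hℓ : 0 < ℓ) (hℓ' : ℓ < 1) (hmaps : MapsTo (φ^[s]) (closedArc a ℓ) (closedArc a ℓ)) :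
    H (a + ℓ) = H a := by
  have hlift : ∀ t ∈ Icc a (a + ℓ), ∃ k : ℤ, F^[s] t ∈ Icc (a + k) (a + ℓ + k) := by
    intro t ht
    obtain ⟨r, hr, hrt⟩ := hmaps (mem_image_of_mem _ ht)
    change (r : UnitAddCircle) = _ at hrt
    rw [hF.iterate_coe] at hrt
    obtain ⟨k, hk⟩ := coe_circle_eq_iff.1 hrt.symm
    exact ⟨k, by linarith [hr.1], by linarith [hr.2]⟩
  obtain ⟨k, hk⟩ := hlift a ⟨le_rfl, by linarith⟩
  have hend : F^[s] (a + ℓ) ≤ a + ℓ + k := by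
    by_contra! hlt
    set y := min (F^[s] (a + ℓ)) ((a + ℓ + k + (a + k + 1)) / 2) with hy
    have hy1 : a + ℓ + k < y := lt_min hlt (by linarith)
    have hy2 : y < a + k + 1 := lt_of_le_of_lt (min_le_right _ _) (by linarith)
    obtain ⟨t, ht, hty⟩ := intermediate_value_Icc (by linarith : a ≤ a + ℓ)
      (hF.1.iterate s).continuousOn ⟨by linarith [hk.2], min_le_left _ _⟩
    obtain ⟨j, hj⟩ := hlift t ht
    rw [hty] at hj
    have h1 : (j : ℝ) < k + 1 := by linarith [hj.1]
    have h2 : (k : ℝ) < j := by linarith [hj.2]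
    have : j < k + 1 := by exact_mod_cast h1
    have : k < j := by exact_mod_cast h2
    lia
  have h1 := hH.monotone hend
  have h2 := hH.monotone hk.1
  rw [hH.add_int, hH.map_iterate] at h1 h2
  have h3 : H a ≤ H (a + ℓ) := hH.monotone (by linarith)
  have h4 : (2 : ℝ) ≤ 2 ^ s := le_self_pow₀ one_le_two (by lia)
  nlinarith

/-- A fixed point outside all preimages of maximal periodic intervals is not identified with
any other point by the semiconjugacy. -/
theorem eq_of_semiconjLift_eq_zero {φ : UnitAddCircle → UnitAddCircle} {F H : ℝ → ℝ}
    (hF : IsLiftDeg2 φ F) (hH : IsSemiconjLift F H) {a : ℝ} (hFa : F a = a)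
    (ha : (a : UnitAddCircle) ∈ lambdaSet φ) {x : ℝ} (hx : H x = 0) : x = a := by
  have hHa : H a = 0 := by
    have := hH.map a
    rw [hFa] at this
    linarith
  by_contra hne
  obtain ⟨p, q, hpq⟩ := hH.exists_fiber_eq_Icc a
  rw [hHa] at hpq
  have hxm := (hpq x).1 hx
  have ham := (hpq a).1 hHa
  have hlt : p < q := by
    rcases lt_or_gt_of_ne hne with h | h
    · linarith [hxm.1, ham.2]
    · linarith [hxm.2, ham.1]
  have hp : H p = 0 := (hpq p).2 ⟨le_rfl, hlt.le⟩
  have hq : H q = 0 := (hpq q).2 ⟨hlt.le, le_rfl⟩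
  have hqp : q < p + 1 := hH.lt_add_one_of_eq (hp.trans hq.symm)
  have hI : closedArc p (q - p) = (fun t : ℝ => (t : UnitAddCircle)) '' Icc p q := by
    rw [closedArc, add_sub_cancel]
  have hper : IsPeriodicInterval φ 1 (closedArc p (q - p)) := by
    refine ⟨le_rfl, ⟨p, q - p, by linarith, by linarith, rfl⟩, ?_, ?_, ?_⟩
    · rw [hI, Function.iterate_one]
      rintro _ ⟨t, ht, rfl⟩
      exact ⟨F t, (hpq _).1 (by rw [hH.map, (hpq t).2 ht, mul_zero]), (hF.2.2.2 t).symm⟩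
    · rw [hI, Function.iterate_one]
      rintro _ ⟨t, ht, rfl⟩ _ ⟨r, hr, rfl⟩ h
      change φ (t : UnitAddCircle) = φ (r : UnitAddCircle) at h
      rw [hF.2.2.2, hF.2.2.2] at h
      obtain ⟨k, hk⟩ := coe_circle_eq_iff.1 h
      have h1 := congrArg H hk
      rw [hH.add_int, hH.map, hH.map, (hpq t).2 ht, (hpq r).2 hr] at h1
      have h2 : (k : ℝ) = 0 := by linarith
      rw [h2, add_zero] at hk
      rw [hF.2.1.injective hk]
    · rw [hI, Function.iterate_one]
      rintro _ ⟨t, ht, rfl⟩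
      obtain ⟨r, rfl⟩ := hF.surjective t
      have h1 := (hpq _).2 ht
      rw [hH.map] at h1
      exact ⟨r, ⟨r, (hpq r).1 (by linarith), rfl⟩, hF.2.2.2 r⟩
  have hmax : IsMaxPeriodicInterval φ (closedArc p (q - p)) := by
    refine ⟨⟨1, hper⟩, ?_⟩
    rintro J ⟨s, hs, ⟨b, ℓ, hℓ, hℓ', rfl⟩, hbij⟩ hsub
    refine Subset.antisymm hsub ?_
    have hcol := hH.eq_of_mapsTo_arc hF hs hℓ hℓ' hbij.mapsTo
    have hconst : ∀ t ∈ Icc b (b + ℓ), H t = H b := fun t ht =>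
      le_antisymm (hcol ▸ hH.monotone ht.2) (hH.monotone ht.1)
    obtain ⟨r, hr, hra⟩ := hsub (hI ▸ mem_image_of_mem _ ham)
    obtain ⟨k, hk⟩ := coe_circle_eq_iff.1 hra
    have hHr : H b = k := by rw [← hconst r hr, hk, hH.add_int, hHa, zero_add]
    rintro _ ⟨t, ht, rfl⟩
    rw [hI]
    refine ⟨t + (-k : ℤ), (hpq _).1 ?_, coe_circle_eq_iff.2 ⟨-k, rfl⟩⟩
    rw [hH.add_int, hconst t ht, hHr]
    push_cast; ring
  refine ha.2 (mem_iUnion.2 ⟨0, ?_⟩)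
  exact mem_biUnion (show closedArc p (q - p) ∈ {I | IsMaxPeriodicInterval φ I} from hmax)
    (hI ▸ mem_image_of_mem _ ham)

/-- Bounded distortion on a single step: the derivative of a `C²` lift with positive derivative
varies by a factor controlled by the distance. -/
theorem IsLiftDeg2.exists_deriv_le_mul_exp {φ : UnitAddCircle → UnitAddCircle} {F : ℝ → ℝ}
    (hF : IsLiftDeg2 φ F) (hC2 : ContDiff ℝ 2 F) (hpos : ∀ x, 0 < deriv F x) :
    ∃ C, 0 ≤ C ∧ ∀ x y, deriv F x ≤ deriv F y * Real.exp (C * |x - y|) := by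
  have hd1 : ContDiff ℝ 1 (deriv F) := by
    have : ContDiff ℝ (1 + 1) F := hC2
    exact (contDiff_succ_iff_deriv.1 this).2.2
  have hper : Function.Periodic (deriv F) 1 := by
    intro x
    have h1 : (fun y => F (y + 1)) = fun y => F y + 2 := funext hF.2.2.1
    have h2 := congrArg (fun f => deriv f x) h1
    simpa only [deriv_comp_add_const, deriv_add_const] using h2
  have hper2 : Function.Periodic (deriv (deriv F)) 1 := by
    intro x
    have h1 : (fun y => deriv F (y + 1)) = deriv F := funext hper
    have h2 := congrArg (fun f => deriv f x) h1
    simpa only [deriv_comp_add_const] using h2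
  obtain ⟨K, hK⟩ := exists_abs_le_of_continuous_periodic (hd1.continuous_deriv le_rfl) hper2
  obtain ⟨M, hM⟩ := exists_abs_le_of_continuous_periodic
    (f := fun x => (deriv F x)⁻¹) (hd1.continuous.inv₀ fun x => (hpos x).ne')
    (fun x => by simp only [hper x])
  have hK0 : 0 ≤ K := (abs_nonneg _).trans (hK 0)
  have hM0 : 0 ≤ M := (abs_nonneg _).trans (hM 0)
  refine ⟨K * M, mul_nonneg hK0 hM0, fun x y => ?_⟩
  have h1 : |deriv F x - deriv F y| ≤ K * |x - y| :=
    Convex.norm_image_sub_le_of_norm_deriv_le (s := univ)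
      (fun z _ => (hd1.differentiable one_ne_zero) z) (fun z _ => hK z) convex_univ
      (mem_univ y) (mem_univ x)
  have h2 : 1 ≤ deriv F y * M := by
    have := (abs_le.1 (hM y)).2
    calc (1 : ℝ) = deriv F y * (deriv F y)⁻¹ := (mul_inv_cancel₀ (hpos y).ne').symm
      _ ≤ _ := by gcongr; exact (hpos y).le
  have h3 : K * |x - y| ≤ deriv F y * M * (K * |x - y|) :=
    le_mul_of_one_le_left (by positivity) h2
  calc deriv F x ≤ deriv F y * (K * M * |x - y| + 1) := by linarith [(abs_le.1 h1).2]
    _ ≤ _ := by gcongr; exacts [(hpos y).le, Real.add_one_le_exp _]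

/-- Denjoy–Schwartz estimate: intervals adjacent to one whose iterates have summable lengths
have comparable iterates. -/
theorem iterate_sub_le_of_sum_le {F : ℝ → ℝ} (hm : StrictMono F) (hd : Differentiable ℝ F)
    {C : ℝ} (hC : 0 ≤ C) (hdist : ∀ x y, deriv F x ≤ deriv F y * Real.exp (C * |x - y|))
    (hpos : ∀ x, 0 < deriv F x) {p q w : ℝ} (hpq : p < q) (hqw : q < w)
    (hsum : ∀ n, ∑ i ∈ Finset.range n, (F^[i] q - F^[i] p) ≤ 1)
    (hw : w - q ≤ Real.exp (-(2 * C)) * (q - p)) (n : ℕ) :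
    F^[n] w - F^[n] q ≤ F^[n] q - F^[n] p := by
  have key : ∀ n, F^[n] w - F^[n] q ≤
      Real.exp (2 * C * (∑ i ∈ Finset.range n, (F^[i] q - F^[i] p) - 1)) *
        (F^[n] q - F^[n] p) := by
    intro n
    induction n with
    | zero =>
      simp only [Finset.range_zero, Finset.sum_empty, Function.iterate_zero, id]
      rwa [show 2 * C * (0 - 1) = -(2 * C) by ring]
    | succ n ih =>
      have h1 : F^[n] p < F^[n] q := hm.iterate n hpq
      have h2 : F^[n] q < F^[n] w := hm.iterate n hqw
      obtain ⟨ξ, hξ, hξ'⟩ := exists_deriv_eq_slope F h2 hd.continuous.continuousOn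
        hd.differentiableOn
      obtain ⟨η, hη, hη'⟩ := exists_deriv_eq_slope F h1 hd.continuous.continuousOn
        hd.differentiableOn
      rw [eq_div_iff (by linarith)] at hξ' hη'
      rw [Finset.sum_range_succ]
      simp only [Function.iterate_succ_apply']
      rw [← hξ', ← hη']
      set S := ∑ i ∈ Finset.range n, (F^[i] q - F^[i] p) with hS
      have hle : F^[n] w - F^[n] q ≤ F^[n] q - F^[n] p := by
        refine ih.trans (mul_le_of_le_one_left (by linarith) (Real.exp_le_one_iff.2 ?_))
        exact mul_nonpos_of_nonneg_of_nonpos (by linarith) (by linarith [hsum n])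
      have habs : |ξ - η| ≤ 2 * (F^[n] q - F^[n] p) := by
        rw [abs_of_nonneg (by linarith [hξ.1, hη.2])]
        linarith [hξ.2, hη.1]
      calc deriv F ξ * (F^[n] w - F^[n] q)
          ≤ (deriv F η * Real.exp (C * (2 * (F^[n] q - F^[n] p)))) *
            (Real.exp (2 * C * (S - 1)) * (F^[n] q - F^[n] p)) := by
            refine mul_le_mul ((hdist ξ η).trans ?_) ih (by linarith)
              (mul_nonneg (hpos η).le (Real.exp_pos _).le)
            have := (hpos η).le
            gcongr
        _ = _ := by
          rw [show 2 * C * (S + (F^[n] q - F^[n] p) - 1) =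
            C * (2 * (F^[n] q - F^[n] p)) + 2 * C * (S - 1) by ring, Real.exp_add]
          ring
  refine (key n).trans (mul_le_of_le_one_left ?_ (Real.exp_le_one_iff.2 ?_))
  · linarith [hm.iterate n hpq]
  · exact mul_nonpos_of_nonneg_of_nonpos (by linarith) (by linarith [hsum n])

/-- There are no wandering intervals: the image of a nontrivial fibre of the semiconjugacy is
eventually periodic under doubling. -/
theorem exists_periodic_of_fiber_nontrivial {φ : UnitAddCircle → UnitAddCircle} {F H : ℝ → ℝ}
    (hF : IsLiftDeg2 φ F) (hC2 : ContDiff ℝ 2 F) (hpos : ∀ x, 0 < deriv F x)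
    (hH : IsSemiconjLift F H) {x y : ℝ} (hxy : x < y) (hHxy : H x = H y) :
    ∃ (N M : ℕ) (k : ℤ), N < M ∧ 2 ^ M * H x = 2 ^ N * H x + k := by
  by_contra! hwander
  obtain ⟨p, q, hpq⟩ := hH.exists_fiber_eq_Icc x
  have hxm := (hpq x).1 rfl
  have hym := (hpq y).1 hHxy.symm
  have hlt : p < q := by linarith [hxm.1, hym.2]
  have hp : H p = H x := (hpq p).2 ⟨le_rfl, hlt.le⟩
  have hq : H q = H x := (hpq q).2 ⟨hlt.le, le_rfl⟩
  have hval : ∀ i t, t ∈ Icc (F^[i] p) (F^[i] q) → H t = 2 ^ i * H x := by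
    intro i t ht
    apply le_antisymm
    · rw [← hq, ← hH.map_iterate]; exact hH.monotone ht.2
    · rw [← hp, ← hH.map_iterate]; exact hH.monotone ht.1
  have hlen : ∀ i, F^[i] q < F^[i] p + 1 := fun i =>
    hH.lt_add_one_of_eq (by rw [hH.map_iterate, hH.map_iterate, hp, hq])
  have hmono : ∀ i, F^[i] p < F^[i] q := fun i => hF.2.1.iterate i hlt
  have hne : ∀ (i j : ℕ) (k : ℤ), i ≠ j → (2 : ℝ) ^ i * H x ≠ 2 ^ j * H x + k := by
    intro i j k hij h
    rcases lt_or_gt_of_ne hij with h1 | h1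
    · exact hwander i j (-k) h1 (by push_cast; linarith)
    · exact hwander j i k h1 h
  have hsum : ∀ n, ∑ i ∈ Finset.range n, (F^[i] q - F^[i] p) ≤ 1 := by
    intro n
    set A := fun i : ℕ => (fun t : ℝ => (t : UnitAddCircle)) '' Icc (F^[i] p) (F^[i] q) with hA
    have hdisj : (↑(Finset.range n) : Set ℕ).PairwiseDisjoint A := by
      intro i _ j _ hij
      refine Set.disjoint_left.2 ?_
      rintro _ ⟨s, hs, rfl⟩ ⟨t, ht, hst⟩
      obtain ⟨k, hk⟩ := coe_circle_eq_iff.1 hst.symm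
      have := congrArg H hk
      rw [hH.add_int, hval i s hs, hval j t ht] at this
      exact hne i j k hij this
    have hmeas : ∀ i ∈ Finset.range n, MeasurableSet (A i) := fun i _ =>
      (isCompact_Icc.image (AddCircle.continuous_mk' 1)).isClosed.measurableSet
    have h1 := measure_biUnion_finset (μ := volume) hdisj hmeas
    have h2 : volume (⋃ i ∈ Finset.range n, A i) ≤ 1 :=
      (measure_mono (subset_univ _)).trans (UnitAddCircle.measure_univ).le
    rw [h1, Finset.sum_congr rfl fun i _ => volume_coe_image_Icc (hlen i),
      ← ENNReal.ofReal_sum_of_nonneg fun i _ => by linarith [hmono i]] at h2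
    exact (ENNReal.ofReal_le_one).1 h2
  obtain ⟨C, hC, hdist⟩ := hF.exists_deriv_le_mul_exp hC2 hpos
  set w := q + Real.exp (-(2 * C)) * (q - p) with hw
  have hqw : q < w := by
    have : 0 < Real.exp (-(2 * C)) * (q - p) := mul_pos (Real.exp_pos _) (by linarith)
    linarith
  have hbound := iterate_sub_le_of_sum_le hF.2.1 (hC2.differentiable two_ne_zero) hC hdist hpos
    hlt hqw hsum (by rw [hw]; linarith)
  have hHw : H x < H w := by
    refine lt_of_le_of_ne (hq ▸ hH.monotone hqw.le) fun h => ?_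
    linarith [((hpq w).1 h.symm).2]
  obtain ⟨n, hn⟩ := pow_unbounded_of_one_lt (2 / (H w - H x)) one_lt_two
  rw [div_lt_iff₀ (by linarith)] at hn
  have h1 := hH.sub_le (F^[n] q) (F^[n] w)
  rw [hH.map_iterate, hH.map_iterate, hq] at h1
  linarith [hbound n, hlen n]

/-- A fixed nondegenerate arc is eventually not contained in any iterated preimage of shrinking
right neighbourhoods `[a, b n]` of a fixed point of `F` in `Λ`. -/
theorem eventually_not_preimage_contains {φ : UnitAddCircle → UnitAddCircle} {F H : ℝ → ℝ}
    (hF : IsLiftDeg2 φ F) (hC2 : ContDiff ℝ 2 F) (hpos : ∀ x, 0 < deriv F x)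
    (hH : IsSemiconjLift F H) {a : ℝ} (hFa : F a = a) (ha : (a : UnitAddCircle) ∈ lambdaSet φ)
    {b : ℕ → ℝ} (hb : ∀ n, F (b (n + 1)) = b n) {u v : ℝ} (huv : u < v) :
    ∀ᶠ n in atTop, ∀ (i : ℕ) (k : ℤ), ¬ (a + k ≤ F^[i] u ∧ F^[i] v ≤ b n + k) := by
  have hHa : H a = 0 := by
    have := hH.map a
    rw [hFa] at this
    linarith
  have hHb : ∀ n, H (b n) = H (b 0) / 2 ^ n := by
    intro n
    induction n with
    | zero => simp
    | succ n ih =>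
      have := hH.map (b (n + 1))
      rw [hb, ih] at this
      rw [pow_succ, ← div_div, this]; ring
  have hlim : Tendsto (fun n => H (b n)) atTop (𝓝 0) := by
    refine Tendsto.congr (fun n => (hHb n).symm) ?_
    exact tendsto_const_nhds.div_atTop (tendsto_pow_atTop_atTop_of_one_lt one_lt_two)
  have hbounds : ∀ n i (k : ℤ), a + k ≤ F^[i] u → F^[i] v ≤ b n + k →
      (k : ℝ) ≤ 2 ^ i * H u ∧ 2 ^ i * H v ≤ H (b n) + k := by
    intro n i k h1 h2
    have h3 := hH.monotone h1
    have h4 := hH.monotone h2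
    rw [hH.add_int, hH.map_iterate] at h3 h4
    exact ⟨by linarith, h4⟩
  rcases (hH.monotone huv.le).lt_or_eq with hlt | heq
  · filter_upwards [hlim.eventually_lt_const (sub_pos.2 hlt)] with n hn i k ⟨h1, h2⟩
    obtain ⟨h3, h4⟩ := hbounds n i k h1 h2
    have h5 : (1 : ℝ) ≤ 2 ^ i := one_le_pow₀ one_le_two
    nlinarith
  · obtain ⟨N, M, m, hNM, hm⟩ := exists_periodic_of_fiber_nontrivial hF hC2 hpos hH huv heq
    have hpow : (2 : ℝ) ^ N < 2 ^ M := pow_lt_pow_right₀ one_lt_two hNM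
    have hQ : (0 : ℝ) < 2 ^ M - 2 ^ N := by linarith
    filter_upwards [hlim.eventually_lt_const (inv_pos.2 hQ)] with n hn i k ⟨h1, h2⟩
    obtain ⟨h3, h4⟩ := hbounds n i k h1 h2
    rw [← heq] at h4
    have hint : (2 ^ M - 2 ^ N) * (2 ^ i * H u - k)
        = ((2 ^ i * m - (2 ^ M - 2 ^ N) * k : ℤ) : ℝ) := by
      push_cast
      linear_combination (2 : ℝ) ^ i * hm
    have hnn : 0 ≤ (2 ^ M - 2 ^ N) * (2 ^ i * H u - k) := mul_nonneg hQ.le (by linarith)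
    have hlt1 : (2 ^ M - 2 ^ N) * (2 ^ i * H u - k) < 1 := by
      rw [← mul_inv_cancel₀ hQ.ne']
      exact mul_lt_mul_of_pos_left (by linarith) hQ
    rw [hint] at hnn hlt1
    have hzero : 2 ^ i * m - (2 ^ M - 2 ^ N) * k = 0 := by
      have h5 : 0 ≤ 2 ^ i * m - (2 ^ M - 2 ^ N) * k := by exact_mod_cast hnn
      have h6 : 2 ^ i * m - (2 ^ M - 2 ^ N) * k < 1 := by exact_mod_cast hlt1
      lia
    rw [hzero, Int.cast_zero, mul_eq_zero, or_iff_right hQ.ne'] at hint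
    have hfib : ∀ t, H t = H u → F^[i] t = a + k := by
      intro t ht
      have := eq_of_semiconjLift_eq_zero hF hH hFa ha (x := F^[i] t + (-k : ℤ)) (by
        rw [hH.add_int, hH.map_iterate, ht]
        push_cast
        linarith)
      push_cast at this
      linarith
    have := hF.2.1.iterate i huv
    rw [hfib u rfl, hfib v heq.symm] at this
    exact this.false

/-- The main theorem for a lift fixing the left endpoint of the nice interval. -/
theorem pullback_nice_intervals_shrink_of_fixed
    (φ : UnitAddCircle → UnitAddCircle) (F : ℝ → ℝ)
    (hF : IsLiftDeg2 φ F) (hC2 : ContDiff ℝ 2 F) (hpos : ∀ x : ℝ, 0 < deriv F x)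
    (a₀ ℓ₀ : ℝ) (hℓ₀ : 0 < ℓ₀) (hℓ₀' : ℓ₀ < 1)
    (ha : (a₀ : UnitAddCircle) ∈ lambdaSet φ) (hFa : F a₀ = a₀)
    (B : ℕ → Set UnitAddCircle) (hB0 : B 0 = closedArc a₀ ℓ₀) (hB0nice : IsNice φ (B 0))
    (hBrec : ∀ n : ℕ, B (n + 1) = connectedComponentIn (φ ⁻¹' B n) (a₀ : UnitAddCircle)) :
    (∀ n, IsNiceInterval φ (B n)) ∧
    Filter.Tendsto (fun n : ℕ => volume (B n)) Filter.atTop (nhds 0) ∧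
    Filter.Tendsto (fun n : ℕ =>
      sSup {t : ℝ | ∃ (i : ℕ) (J : Set UnitAddCircle),
        IsComponentOf J ((φ^[i]) ⁻¹' B n) ∧ t = (volume J).toReal})
      Filter.atTop (nhds 0) := by
  obtain ⟨H, hH⟩ := hF.exists_semiconjLift
  have hHa : H a₀ = 0 := by
    have := hH.map a₀
    rw [hFa] at this
    linarith
  choose G hG using hF.surjective
  set b : ℕ → ℝ := fun n => G^[n] (a₀ + ℓ₀) with hbdef
  have hb : ∀ n, F (b (n + 1)) = b n := fun n => by
    simp only [hbdef, Function.iterate_succ_apply', hG]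
  have hb0 : b 0 = a₀ + ℓ₀ := rfl
  have hab : ∀ n, a₀ < b n := by
    intro n
    induction n with
    | zero => linarith
    | succ n ih => rwa [← hF.2.1.lt_iff_lt, hFa, hb]
  have hHpos : ∀ n, 0 < H (b n) := fun n => by
    refine lt_of_le_of_ne (hHa ▸ hH.monotone (hab n).le) fun h => ?_
    exact (hab n).ne' (eq_of_semiconjLift_eq_zero hF hH hFa ha h.symm)
  have hbstep : ∀ n, b (n + 1) < b n := fun n => by
    refine hH.monotone.reflect_lt ?_
    have := hH.map (b (n + 1))
    rw [hb] at this
    linarith [hHpos (n + 1)]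
  have hb1 : ∀ n, b n < a₀ + 1 := by
    intro n
    induction n with
    | zero => linarith
    | succ n ih => linarith [hbstep n]
  have hB : ∀ n, B n = (fun t : ℝ => (t : UnitAddCircle)) '' Icc a₀ (b n) := by
    intro n
    induction n with
    | zero => exact hB0
    | succ n ih =>
      rw [hBrec, ih]
      exact connectedComponentIn_preimage_arc (k := 0) hF.1 hF.2.1 hF.2.2.2 (hb1 n)
        (by simp [hFa]) (by simp [hb]) ⟨le_rfl, (hab _).le⟩
  have hev := fun {u v : ℝ} (huv : u < v) =>
    eventually_not_preimage_contains hF hC2 hpos hH hFa ha hb huv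
  refine ⟨fun n => ⟨⟨a₀, b n - a₀, by linarith [hab n], by linarith [hb1 n], ?_⟩, ?_⟩, ?_, ?_⟩
  · rw [hB, closedArc, add_sub_cancel]
  · induction n with
    | zero => exact hB0nice
    | succ n ih =>
      have hint : interior (B (n + 1)) ⊆ interior (B n) := by
        rw [hB, hB]
        exact interior_mono (image_mono (Icc_subset_Icc_right (hbstep n).le))
      have hfr : ∀ n, frontier (B n) = {(a₀ : UnitAddCircle), (b n : UnitAddCircle)} := fun n => by
        rw [hB, frontier_coe_image_Icc (hab n).le (hb1 n)]
      intro m hm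
      rw [hfr, ← disjoint_iff_inter_eq_empty, Set.disjoint_left]
      rintro _ ⟨z, rfl | rfl, rfl⟩ hz
      · rw [hF.iterate_coe, Function.iterate_fixed hFa, hB] at hz
        exact coe_left_notMem_interior (hb1 _) hz
      · obtain ⟨j, rfl⟩ : ∃ j, m = j + 1 := ⟨m - 1, by lia⟩
        rw [Function.iterate_succ_apply, hF.2.2.2, hb] at hz
        have hz' := hint hz
        rcases Nat.eq_zero_or_pos j with rfl | hj
        · rw [Function.iterate_zero_apply, hB] at hz'
          exact coe_right_notMem_interior (hb1 _) hz'
        · have := ih j hj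
          rw [← disjoint_iff_inter_eq_empty, Set.disjoint_left] at this
          exact this (mem_image_of_mem _ (by rw [hfr]; exact Or.inr rfl)) hz'
  · have hlim : Tendsto b atTop (𝓝 a₀) := by
      refine tendsto_order.2 ⟨fun u hu => Eventually.of_forall fun n => hu.trans (hab n),
        fun v hv => ?_⟩
      filter_upwards [hev hv] with n hn
      by_contra! hle
      exact hn 0 0 (by simpa using hle)
    have : Tendsto (fun n => ENNReal.ofReal (b n - a₀)) atTop (𝓝 (ENNReal.ofReal (a₀ - a₀))) :=
      (ENNReal.continuous_ofReal.tendsto _).comp (hlim.sub_const _)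
    rw [sub_self, ENNReal.ofReal_zero] at this
    exact this.congr fun n => by rw [hB, volume_coe_image_Icc (hb1 n)]
  · rw [Metric.tendsto_atTop']
    intro ε hε
    set δ := ε / 4 with hδ
    have hδ0 : 0 < δ := by positivity
    have hgrid : ∀ᶠ n in atTop, ∀ j ∈ Finset.range (⌈1 / δ⌉₊ + 1), ∀ (i : ℕ) (k : ℤ),
        ¬ (a₀ + k ≤ F^[i] (j * δ) ∧ F^[i] ((j + 1) * δ) ≤ b n + k) :=
      (Filter.eventually_all_finset _).2 fun j _ => hev (by nlinarith)
    obtain ⟨N, hN⟩ := eventually_atTop.1 hgrid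
    refine ⟨N, fun n hn => ?_⟩
    have hle : ∀ t ∈ {t : ℝ | ∃ (i : ℕ) (J : Set UnitAddCircle),
        IsComponentOf J ((φ^[i]) ⁻¹' B n) ∧ t = (volume J).toReal}, t ≤ 2 * δ := by
      rintro _ ⟨i, J, ⟨z, hz, rfl⟩, rfl⟩
      obtain ⟨x, rfl⟩ := QuotientAddGroup.mk_surjective z
      have hm := hF.2.1.iterate i
      have hz2 := hz
      rw [mem_preimage, hB] at hz2
      obtain ⟨s, hs, hsx⟩ := hz2
      change (s : UnitAddCircle) = φ^[i] (x : UnitAddCircle) at hsx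
      rw [hF.iterate_coe] at hsx
      obtain ⟨k, hk⟩ := coe_circle_eq_iff.1 hsx.symm
      obtain ⟨α, hα⟩ := hF.surjective.iterate i (a₀ + k)
      obtain ⟨β, hβ⟩ := hF.surjective.iterate i (b n + k)
      have hαβ : α ≤ β := hm.le_iff_le.1 (by linarith [hab n])
      have hβα : β < α + 1 := by
        refine hm.lt_iff_lt.1 ?_
        have h1 := hF.iterate_add_int i α 1
        have h2 : (1 : ℝ) ≤ 2 ^ i := one_le_pow₀ one_le_two
        push_cast at h1
        linarith [hb1 n]
      have hxI : x ∈ Icc α β :=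
        ⟨hm.le_iff_le.1 (by linarith [hs.1]), hm.le_iff_le.1 (by linarith [hs.2])⟩
      have hcomp := connectedComponentIn_preimage_arc (hF.1.iterate i) hm (hF.iterate_coe i)
        (hb1 n) hα hβ hxI
      rw [← hB] at hcomp
      change (volume (connectedComponentIn (φ^[i] ⁻¹' B n) (x : UnitAddCircle))).toReal ≤ _
      rw [hcomp, volume_coe_image_Icc hβα, ENNReal.toReal_ofReal (by linarith)]
      by_contra! hlong
      have hf0 := Int.fract_nonneg α
      have hf1 := Int.fract_lt_one α
      have hfl : α + (-⌊α⌋ : ℤ) = Int.fract α := by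
        push_cast
        linarith [Int.floor_add_fract α]
      have hj1 : Int.fract α / δ ≤ ⌈Int.fract α / δ⌉₊ := Nat.le_ceil _
      have hj2 := Nat.ceil_lt_add_one (div_nonneg hf0 hδ0.le)
      rw [div_le_iff₀ hδ0] at hj1
      have hj3 : ((⌈Int.fract α / δ⌉₊ : ℝ) - 1) * δ < Int.fract α := by
        rw [← lt_div_iff₀ hδ0]; linarith
      refine hN n hn.le ⌈Int.fract α / δ⌉₊ ?_ i (k + 2 ^ i * (-⌊α⌋)) ⟨?_, ?_⟩
      · rw [Finset.mem_range, Nat.lt_succ_iff]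
        exact Nat.ceil_mono (by gcongr)
      · have h1 := hm.monotone hj1
        rw [show F^[i] (Int.fract α) = F^[i] (α + (-⌊α⌋ : ℤ)) by rw [hfl],
          hF.iterate_add_int, hα] at h1
        push_cast at h1 ⊢
        linarith
      · have h1 : (⌈Int.fract α / δ⌉₊ + 1) * δ ≤ β + (-⌊α⌋ : ℤ) := by
          linarith
        have h2 := hm.monotone h1
        rw [hF.iterate_add_int, hβ] at h2
        push_cast at h2 ⊢
        linarith
    have hnn : 0 ≤ sSup {t : ℝ | ∃ (i : ℕ) (J : Set UnitAddCircle),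
        IsComponentOf J ((φ^[i]) ⁻¹' B n) ∧ t = (volume J).toReal} := by
      refine Real.sSup_nonneg ?_
      rintro _ ⟨i, J, _, rfl⟩
      exact ENNReal.toReal_nonneg
    rw [Real.dist_eq, sub_zero, abs_of_nonneg hnn]
    exact (Real.sSup_le hle (by positivity)).trans_lt (by linarith)

/-- the pulled-back nice intervals `Bₙ` around a right-accumulated
fixed point `x₀ ∈ Λ` are nice, shrink to `x₀`, and the suprema `εₙ` of the lengths
(Haar measures) of the components of all preimages `φ⁻ⁱ(Bₙ)` tend to `0`. -/
theorem pullback_nice_intervals_shrink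
    (φ : UnitAddCircle → UnitAddCircle) (F : ℝ → ℝ)
    (hF : IsLiftDeg2 φ F) (hC2 : ContDiff ℝ 2 F) (hpos : ∀ x : ℝ, 0 < deriv F x)
    (hnc : ¬ ConjugateToDoubling φ)
    (hfin : {I | IsMaxPeriodicInterval φ I}.Finite)
    (hne : {I | IsMaxPeriodicInterval φ I}.Nonempty)
    (x₀ : UnitAddCircle) (hx₀ : x₀ ∈ lambdaSet φ) (hfix : φ x₀ = x₀)
    (hacc : ∀ ε : ℝ, 0 < ε → (rightArc x₀ ε ∩ lambdaSet φ).Nonempty)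
    (B : ℕ → Set UnitAddCircle)
    (a₀ ℓ₀ : ℝ) (hℓ₀ : 0 < ℓ₀) (hℓ₀' : ℓ₀ < 1)
    (hB0 : B 0 = closedArc a₀ ℓ₀) (ha₀ : x₀ = (a₀ : UnitAddCircle))
    (hB0nice : IsNice φ (B 0))
    (hBrec : ∀ n : ℕ, B (n + 1) = connectedComponentIn (φ ⁻¹' B n) x₀) :
    (∀ n, IsNiceInterval φ (B n)) ∧
    Filter.Tendsto (fun n : ℕ => volume (B n)) Filter.atTop (nhds 0) ∧
    Filter.Tendsto (fun n : ℕ =>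
      sSup {t : ℝ | ∃ (i : ℕ) (J : Set UnitAddCircle),
        IsComponentOf J ((φ^[i]) ⁻¹' B n) ∧ t = (volume J).toReal})
      Filter.atTop (nhds 0) := by
  subst ha₀
  have hfix' := hfix
  rw [hF.2.2.2] at hfix'
  obtain ⟨k, hk⟩ := coe_circle_eq_iff.1 hfix'
  have hderiv : deriv (fun x => F x - k) = deriv F := by
    funext x
    exact deriv_sub_const _
  refine pullback_nice_intervals_shrink_of_fixed φ (fun x => F x - k) ⟨?_, ?_, ?_, ?_⟩ ?_ ?_
    a₀ ℓ₀ hℓ₀ hℓ₀' hx₀ (by simp [hk]) B hB0 hB0nice hBrec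
  · exact hF.1.sub continuous_const
  · exact fun x y hxy => sub_lt_sub_right (hF.2.1 hxy) _
  · intro x
    change F (x + 1) - k = F x - k + 2
    rw [hF.2.2.1]; ring
  · intro x
    rw [hF.2.2.2]
    exact coe_circle_eq_iff.2 ⟨k, by ring⟩
  · exact hC2.sub contDiff_const
  · rw [hderiv]; exact hpos
end
end

section
/- Let φ be a circle covering map of degree two with φ(0) = 0. Then the action of the Thompson group T_φ on the circle is minimal — i.e., for every x ∈ 𝕊¹ the orbit {g(x) : g ∈ T_φ} is dense in 𝕊¹ — if and only if φ is topologically conjugate to the doubling map x ↦ 2x (mod 1). -/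
open Set Filter MeasureTheory Topology

noncomputable section

/-- The standard map `ℝ → 𝕊¹` identifies two reals iff they differ by an integer. -/
theorem UnitAddCircle.coe_eq_coe_iff_exists_int {x y : ℝ} :
    (x : UnitAddCircle) = (y : UnitAddCircle) ↔ ∃ k : ℤ, y = x + k := by
  rw [← sub_eq_zero, ← AddCircle.coe_sub, AddCircle.coe_eq_zero_iff]
  constructor
  · rintro ⟨k, hk⟩
    refine ⟨-k, ?_⟩
    simp at hk ⊢
    linarith
  · rintro ⟨k, hk⟩
    refine ⟨-k, ?_⟩
    simp [hk]

theorem map_add_int_of_map_add_one {H : ℝ → ℝ} {c : ℝ} (h : ∀ x, H (x + 1) = H x + c)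
    (x : ℝ) (k : ℤ) : H (x + k) = H x + c * k := by
  induction k using Int.induction_on with
  | zero => simp
  | succ i ih =>
    push_cast at ih ⊢
    rw [← add_assoc, h, ih]
    ring
  | pred i ih =>
    have := h (x + ((-(i : ℤ) - 1 : ℤ) : ℝ))
    push_cast at ih this ⊢
    rw [show x + (-(i : ℝ) - 1) + 1 = x + -(i : ℝ) by ring, ih] at this
    linarith

theorem map_iterate_of_map_eq_two_mul {H F : ℝ → ℝ} (h : ∀ x, H (F x) = 2 * H x) (n : ℕ)
    (x : ℝ) : H (F^[n] x) = 2 ^ n * H x := by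
  induction n with
  | zero => simp
  | succ n ih =>
    rw [Function.iterate_succ_apply', h, ih, pow_succ]
    ring

/-- A continuous map of the line satisfying `H (x + 1) = H x + c` with `c > 0` is onto. -/
theorem surjective_of_map_add_one {H : ℝ → ℝ} {c : ℝ} (hc : 0 < c) (hcont : Continuous H)
    (h : ∀ x, H (x + 1) = H x + c) : Function.Surjective H := by
  intro y
  obtain ⟨k, hk⟩ := exists_int_gt ((y - H 0) / c)
  obtain ⟨l, hl⟩ := exists_int_lt ((y - H 0) / c)
  rw [div_lt_iff₀ hc] at hk
  rw [lt_div_iff₀ hc] at hl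
  have hk' := map_add_int_of_map_add_one h 0 k
  have hl' := map_add_int_of_map_add_one h 0 l
  exact mem_range_of_exists_le_of_exists_ge hcont ⟨0 + l, by rw [hl']; linarith⟩
    ⟨0 + k, by rw [hk']; linarith⟩

namespace IsLiftDeg2

variable {φ : UnitAddCircle → UnitAddCircle} {F : ℝ → ℝ}

theorem iterate_add_one (hF : IsLiftDeg2 φ F) (n : ℕ) (x : ℝ) :
    F^[n] (x + 1) = F^[n] x + 2 ^ n := by
  induction n with
  | zero => simp
  | succ n ih =>
    have := map_add_int_of_map_add_one hF.2.2.1 (F^[n] x) (2 ^ n)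
    push_cast at this
    rw [Function.iterate_succ_apply', Function.iterate_succ_apply', ih, this]
    ring

theorem coe_iterate (hF : IsLiftDeg2 φ F) (n : ℕ) (x : ℝ) :
    φ^[n] (x : UnitAddCircle) = ((F^[n] x : ℝ) : UnitAddCircle) := by
  induction n with
  | zero => rfl
  | succ n ih => rw [Function.iterate_succ_apply', Function.iterate_succ_apply', ih, hF.2.2.2]

/-- The `n`-th iterate of the lift, as an order automorphism of the line. -/
def iterateOrderIso (hF : IsLiftDeg2 φ F) (n : ℕ) : ℝ ≃o ℝ :=
  (hF.2.1.iterate n).orderIsoOfSurjective _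
    (surjective_of_map_add_one (by positivity) (hF.1.iterate n) (hF.iterate_add_one n))

@[simp]
theorem iterateOrderIso_apply (hF : IsLiftDeg2 φ F) (n : ℕ) (x : ℝ) :
    hF.iterateOrderIso n x = F^[n] x := rfl

theorem iterateOrderIso_add_int (hF : IsLiftDeg2 φ F) (n : ℕ) (x : ℝ) (k : ℤ) :
    hF.iterateOrderIso n (x + k) = hF.iterateOrderIso n x + 2 ^ n * k :=
  map_add_int_of_map_add_one (hF.iterate_add_one n) x k

/-- The arc bounded by the `i`-th and the `(i + 1)`-st preimage of `0` under `φⁿ`. -/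
def dyadicArc (hF : IsLiftDeg2 φ F) (n : ℕ) (i : ℤ) : Set UnitAddCircle :=
  (fun t : ℝ => (t : UnitAddCircle)) ''
    Icc ((hF.iterateOrderIso n).symm i) ((hF.iterateOrderIso n).symm (i + 1))

theorem isDyadic_dyadicArc (hF : IsLiftDeg2 φ F) (n : ℕ) (i : ℤ) :
    IsDyadic F n (hF.dyadicArc n i) := by
  refine ⟨_, _, ?_, ⟨i, ?_⟩, ?_, rfl⟩
  · simp
  · rw [← hF.iterateOrderIso_apply, OrderIso.apply_symm_apply]
  · simp only [← hF.iterateOrderIso_apply, OrderIso.apply_symm_apply]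

theorem coe_mem_dyadicArc_iff (hF : IsLiftDeg2 φ F) {n : ℕ} {i : ℤ} {t : ℝ} :
    (t : UnitAddCircle) ∈ hF.dyadicArc n i ↔
      ∃ a : ℤ, F^[n] t + 2 ^ n * a ∈ Icc (i : ℝ) (i + 1) := by
  simp only [← hF.iterateOrderIso_apply, ← hF.iterateOrderIso_add_int]
  constructor
  · rintro ⟨s, ⟨hs1, hs2⟩, hst⟩
    obtain ⟨a, rfl⟩ := UnitAddCircle.coe_eq_coe_iff_exists_int.1 hst.symm
    exact ⟨a, (OrderIso.symm_apply_le _).1 hs1, (OrderIso.le_symm_apply _).1 hs2⟩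
  · rintro ⟨a, ha1, ha2⟩
    exact ⟨t + a, ⟨(OrderIso.symm_apply_le _).2 ha1, (OrderIso.le_symm_apply _).2 ha2⟩,
      (UnitAddCircle.coe_eq_coe_iff_exists_int.2 ⟨a, rfl⟩).symm⟩

theorem iUnion_dyadicArc (hF : IsLiftDeg2 φ F) (n : ℕ) (j : ℤ) :
    ⋃ k : Fin (2 ^ n), hF.dyadicArc n ((k : ℕ) + j) = univ := by
  refine eq_univ_of_forall fun x => ?_
  obtain ⟨t, rfl⟩ := QuotientAddGroup.mk_surjective x
  rw [mem_iUnion]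
  set q : ℤ := ⌊F^[n] t⌋ - j with hq
  have hpos : (0 : ℤ) < 2 ^ n := by positivity
  have h0 := Int.emod_nonneg q hpos.ne'
  have h1 := Int.emod_lt_of_pos q hpos
  have h2 := Int.emod_add_mul_ediv q (2 ^ n)
  refine ⟨⟨(q % 2 ^ n).toNat, ?_⟩, hF.coe_mem_dyadicArc_iff.2 ⟨-(q / 2 ^ n), ?_⟩⟩
  · zify
    rwa [Int.toNat_of_nonneg h0]
  · have h3 : (((q % 2 ^ n).toNat : ℤ) : ℝ) = ⌊F^[n] t⌋ - j - 2 ^ n * (q / 2 ^ n : ℤ) := by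
      rw [Int.toNat_of_nonneg h0, show q % 2 ^ n = ⌊F^[n] t⌋ - j - 2 ^ n * (q / 2 ^ n) by omega]
      push_cast
      rfl
    have h4 := Int.floor_le (F^[n] t)
    have h5 := Int.lt_floor_add_one (F^[n] t)
    constructor <;> push_cast at h3 ⊢ <;> rw [h3] <;> linarith

theorem interior_dyadicArc_inter (hF : IsLiftDeg2 φ F) (n : ℕ) (j : ℤ) {k l : Fin (2 ^ n)}
    (hkl : k ≠ l) : interior (hF.dyadicArc n ((k : ℕ) + j)) ∩
      interior (hF.dyadicArc n ((l : ℕ) + j)) = ∅ := by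
  rw [← not_nonempty_iff_eq_empty]
  rintro ⟨x, hx⟩
  obtain ⟨t, rfl⟩ := QuotientAddGroup.mk_surjective x
  set E := hF.iterateOrderIso n
  set U : Set ℝ := (fun s : ℝ => ((E.symm s : ℝ) : UnitAddCircle)) ⁻¹'
    (interior (hF.dyadicArc n ((k : ℕ) + j)) ∩ interior (hF.dyadicArc n ((l : ℕ) + j))) with hU
  have hUo : IsOpen U := (isOpen_interior.inter isOpen_interior).preimage
    ((AddCircle.continuous_mk' 1).comp E.symm.continuous)
  have hUn : U.Nonempty := ⟨E t, by simpa [hU] using hx⟩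
  obtain ⟨s, hs, hsU⟩ := dense_irrational.exists_mem_open hUo hUn
  obtain ⟨a, ha⟩ := hF.coe_mem_dyadicArc_iff.1 (interior_subset hsU.1)
  obtain ⟨b, hb⟩ := hF.coe_mem_dyadicArc_iff.1 (interior_subset hsU.2)
  rw [← hF.iterateOrderIso_apply, OrderIso.apply_symm_apply] at ha hb
  have key : ∀ (c i : ℤ), s + 2 ^ n * c ∈ Icc (i : ℝ) (i + 1) → ⌊s⌋ = i - 2 ^ n * c := by
    intro c i hc
    rw [Int.floor_eq_iff]
    have hne : s ≠ ((i + 1 - 2 ^ n * c : ℤ) : ℝ) := hs.ne_int _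
    have hlt := lt_of_le_of_ne (a := s) (by push_cast; linarith [hc.2]) hne
    push_cast at hlt ⊢
    constructor <;> linarith [hc.1]
  have h1 := (key _ _ ha).symm.trans (key _ _ hb)
  have hdvd : ((2 ^ n : ℕ) : ℤ) ∣ (l : ℕ) - (k : ℕ) := ⟨b - a, by push_cast; linarith⟩
  refine hkl (Fin.ext ?_)
  exact Nat.ModEq.eq_of_lt_of_lt ((Nat.modEq_iff_dvd).2 hdvd) k.2 l.2

/-- Points with the same image under some iterate of `φ` lie in the same orbit of `T_φ`. -/
theorem exists_inThompsonGroup_of_iterate_eq (hF : IsLiftDeg2 φ F) {n : ℕ}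
    {x y : UnitAddCircle} (hxy : φ^[n] x = φ^[n] y) :
    ∃ g, InThompsonGroup φ F g ∧ y = g x := by
  obtain ⟨s, rfl⟩ := QuotientAddGroup.mk_surjective x
  obtain ⟨t, rfl⟩ := QuotientAddGroup.mk_surjective y
  obtain ⟨j, hj⟩ := UnitAddCircle.coe_eq_coe_iff_exists_int.1
    ((hF.coe_iterate n s).symm.trans (hxy.trans (hF.coe_iterate n t)))
  set E := hF.iterateOrderIso n
  set G : ℝ → ℝ := fun x => E.symm (E x + j) with hG
  have hEG : ∀ x, F^[n] (G x) = F^[n] x + j := fun x => E.apply_symm_apply _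
  have hG1 : ∀ x, G (x + 1) = G x + 1 := fun x => by
    apply (hF.iterateOrderIso n).injective
    simp only [hF.iterateOrderIso_apply, hEG, hF.iterate_add_one]
    ring
  have hper : Function.Periodic (fun x => ((G x : ℝ) : UnitAddCircle)) 1 := fun x => by
    simp only [hG1]
    exact UnitAddCircle.coe_eq_coe_iff_exists_int.2 ⟨-1, by simp⟩
  set g : UnitAddCircle → UnitAddCircle := hper.lift
  have hg : ∀ x : ℝ, g (x : UnitAddCircle) = ((G x : ℝ) : UnitAddCircle) := fun x => rfl
  have hGz : ∀ (x : ℝ) (i : ℤ), x ∈ Icc (E.symm i) (E.symm (i + 1)) ↔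
      G x ∈ Icc (E.symm ((i + j : ℤ) : ℝ)) (E.symm ((i + j : ℤ) + 1)) := fun x i => by
    simp only [mem_Icc, OrderIso.symm_apply_le, OrderIso.le_symm_apply, hG,
      OrderIso.apply_symm_apply, Int.cast_add]
    constructor <;> rintro ⟨h1, h2⟩ <;> constructor <;> linarith
  refine ⟨g, ⟨⟨G, ?_, ?_, hG1, hg⟩, 2 ^ n, fun k => hF.dyadicArc n (((k : ℕ) : ℤ) + 0),
    fun k => hF.dyadicArc n ((k : ℕ) + j), fun _ => n, fun _ => n, by positivity,
    fun k => hF.isDyadic_dyadicArc n _, fun k => hF.isDyadic_dyadicArc n _,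
    hF.iUnion_dyadicArc n 0, hF.iUnion_dyadicArc n j,
    fun k l h => hF.interior_dyadicArc_inter n 0 h,
    fun k l h => hF.interior_dyadicArc_inter n j h, ?_, ?_⟩, ?_⟩
  · exact E.symm.continuous.comp (E.continuous.add continuous_const)
  · intro a b hab
    simpa [hG] using hab
  · intro k
    simp only [add_zero]
    ext z
    constructor
    · rintro ⟨_, ⟨r, hr, rfl⟩, rfl⟩
      exact ⟨G r, (hGz r _).1 hr, rfl⟩
    · rintro ⟨r, hr, rfl⟩
      have hr' : G (E.symm (E r - j)) = r := by simp [hG]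
      refine ⟨_, ⟨E.symm (E r - j), (hGz _ _).2 (by rwa [hr']), rfl⟩, ?_⟩
      simp only [hg, hr']
  · intro k z _
    obtain ⟨r, rfl⟩ := QuotientAddGroup.mk_surjective z
    change φ^[n] (g (r : UnitAddCircle)) = φ^[n] (r : UnitAddCircle)
    rw [hg, hF.coe_iterate, hF.coe_iterate, hEG]
    exact (UnitAddCircle.coe_eq_coe_iff_exists_int.2 ⟨j, rfl⟩).symm
  · change (t : UnitAddCircle) = ((G s : ℝ) : UnitAddCircle)
    have : G s = t := (hF.iterateOrderIso n).injective (by simp [hEG, hj])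
    rw [this]

end IsLiftDeg2

theorem iterate_doubling (n : ℕ) (x : UnitAddCircle) : doubling^[n] x = 2 ^ n • x := by
  induction n with
  | zero => simp
  | succ n ih => rw [Function.iterate_succ_apply', ih, doubling, ← two_nsmul, ← mul_nsmul, pow_succ]

/-- The points sharing an iterate under the doubling map with a given point are dense. -/
theorem exists_iterate_doubling_eq_mem_open (x : UnitAddCircle) {U : Set UnitAddCircle}
    (hU : IsOpen U) (hne : U.Nonempty) : ∃ y ∈ U, ∃ n : ℕ, doubling^[n] x = doubling^[n] y := by
  obtain ⟨u, hu⟩ := hne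
  obtain ⟨s, rfl⟩ := QuotientAddGroup.mk_surjective x
  obtain ⟨t, rfl⟩ := QuotientAddGroup.mk_surjective u
  obtain ⟨ε, hε, hb⟩ := Metric.isOpen_iff.1 (hU.preimage (AddCircle.continuous_mk' (1 : ℝ))) t hu
  obtain ⟨n, hn⟩ := exists_pow_lt_of_lt_one hε (show (1 / 2 : ℝ) < 1 by norm_num)
  have h2 : (0 : ℝ) < 2 ^ n := by positivity
  set k : ℤ := ⌊(t - s) * 2 ^ n⌋ with hk
  have hk1 := Int.floor_le ((t - s) * 2 ^ n)
  have hk2 := Int.lt_floor_add_one ((t - s) * 2 ^ n)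
  rw [← hk] at hk1 hk2
  refine ⟨_, hb (show s + k / 2 ^ n ∈ Metric.ball t ε from ?_), n, ?_⟩
  · rw [one_div, inv_pow] at hn
    have h3 : (k : ℝ) / 2 ^ n ≤ t - s := by rwa [div_le_iff₀ h2]
    have h4 : t - s < k / 2 ^ n + (2 ^ n)⁻¹ := by
      rw [← one_div, ← add_div, lt_div_iff₀ h2]
      exact hk2
    rw [Metric.mem_ball, Real.dist_eq, abs_lt]
    constructor <;> linarith
  · rw [iterate_doubling, iterate_doubling]
    change 2 ^ n • (s : UnitAddCircle) = 2 ^ n • ((s + k / 2 ^ n : ℝ) : UnitAddCircle)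
    rw [← AddCircle.coe_nsmul, ← AddCircle.coe_nsmul]
    refine UnitAddCircle.coe_eq_coe_iff_exists_int.2 ⟨k, ?_⟩
    simp only [nsmul_eq_mul, Nat.cast_pow, Nat.cast_ofNat]
    field_simp

theorem dense_orbit_of_conjugateToDoubling {φ : UnitAddCircle → UnitAddCircle} {F : ℝ → ℝ}
    (hF : IsLiftDeg2 φ F) (hconj : ConjugateToDoubling φ) (x : UnitAddCircle) :
    Dense {y | ∃ g, InThompsonGroup φ F g ∧ y = g x} := by
  obtain ⟨h, hh⟩ := hconj
  rw [dense_iff_inter_open]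
  intro U hU hne
  obtain ⟨y, ⟨y, hyU, rfl⟩, n, hn⟩ := exists_iterate_doubling_eq_mem_open (h x)
    (h.isOpenMap U hU) (hne.image h)
  have hsemi : Function.Semiconj h φ doubling := hh
  rw [← (hsemi.iterate_right n).eq, ← (hsemi.iterate_right n).eq] at hn
  exact ⟨y, hyU, hF.exists_inThompsonGroup_of_iterate_eq (h.injective hn)⟩

theorem dense_iterate_preimage_zero {φ : UnitAddCircle → UnitAddCircle} {F : ℝ → ℝ}
    (h0 : φ 0 = 0) (hd : Dense {y | ∃ g, InThompsonGroup φ F g ∧ y = g 0}) :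
    Dense {y | ∃ n : ℕ, φ^[n] y = 0} := by
  refine hd.mono ?_
  rintro _ ⟨g, ⟨-, r, I, J, n, m, -, -, -, hI, -, -, -, -, hg⟩, rfl⟩
  obtain ⟨k, hk⟩ := mem_iUnion.1 (hI.symm ▸ mem_univ (0 : UnitAddCircle))
  exact ⟨m k, by rw [hg k 0 hk, Function.iterate_fixed h0]⟩

/-- A continuous strictly increasing map commuting with the unit translation descends to a
homeomorphism of the circle. -/
theorem exists_homeomorph_of_lift {H : ℝ → ℝ} (hcont : Continuous H) (hmono : StrictMono H)
    (h1 : ∀ x, H (x + 1) = H x + 1) :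
    ∃ h : UnitAddCircle ≃ₜ UnitAddCircle,
      ∀ x : ℝ, h (x : UnitAddCircle) = ((H x : ℝ) : UnitAddCircle) := by
  have hper : Function.Periodic (fun x => ((H x : ℝ) : UnitAddCircle)) 1 := fun x => by
    simp only [h1]
    exact UnitAddCircle.coe_eq_coe_iff_exists_int.2 ⟨-1, by simp⟩
  have hinj : Function.Injective hper.lift := by
    intro x y hxy
    obtain ⟨s, rfl⟩ := QuotientAddGroup.mk_surjective x
    obtain ⟨t, rfl⟩ := QuotientAddGroup.mk_surjective y
    obtain ⟨k, hk⟩ := UnitAddCircle.coe_eq_coe_iff_exists_int.1 hxy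
    have := map_add_int_of_map_add_one h1 s k
    exact UnitAddCircle.coe_eq_coe_iff_exists_int.2
      ⟨k, hmono.injective (by rw [this, one_mul]; exact hk)⟩
  have hsurj : Function.Surjective hper.lift := by
    intro y
    obtain ⟨t, rfl⟩ := QuotientAddGroup.mk_surjective y
    obtain ⟨s, rfl⟩ := surjective_of_map_add_one one_pos hcont h1 t
    exact ⟨(s : UnitAddCircle), rfl⟩
  have hc : Continuous hper.lift :=
    continuous_coinduced_dom.2 ((AddCircle.continuous_mk' (1 : ℝ)).comp hcont)
  exact ⟨Continuous.homeoOfEquivCompactToT2 (f := Equiv.ofBijective _ ⟨hinj, hsurj⟩) hc,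
    fun x => rfl⟩

/-- A degree two lift fixing `0` is semiconjugate to `x ↦ 2 * x` on the line. -/
theorem IsLiftDeg2.exists_semiconj {φ : UnitAddCircle → UnitAddCircle} {F : ℝ → ℝ}
    (hF : IsLiftDeg2 φ F) (h0 : F 0 = 0) :
    ∃ H : ℝ → ℝ, Continuous H ∧ Monotone H ∧ (∀ x, H (x + 1) = H x + 1) ∧
      (∀ x, H (F x) = 2 * H x) ∧ ∀ k : ℤ, H k = k := by
  have hFint : ∀ (n : ℕ) (k : ℤ), F^[n] k = 2 ^ n * k := fun n k => by
    have := hF.iterateOrderIso_add_int n 0 k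
    simpa [Function.iterate_fixed h0] using this
  set u : ℝ → ℕ → ℝ := fun x n => ⌊F^[n] x⌋ / 2 ^ n with hu
  have humono : ∀ x, Monotone (u x) := fun x => monotone_nat_of_le_succ fun n => by
    have h1 : F ⌊F^[n] x⌋ ≤ F (F^[n] x) := hF.2.1.monotone (Int.floor_le _)
    have h2 := hFint 1 ⌊F^[n] x⌋
    rw [Function.iterate_one] at h2
    have h3 : 2 * ⌊F^[n] x⌋ ≤ ⌊F^[n + 1] x⌋ := by
      rw [Int.le_floor, Function.iterate_succ_apply']
      push_cast
      linarith
    have h4 : (2 * ⌊F^[n] x⌋ : ℝ) ≤ ⌊F^[n + 1] x⌋ := by exact_mod_cast h3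
    simp only [hu]
    rw [div_le_div_iff₀ (by positivity) (by positivity), pow_succ]
    nlinarith [show (0 : ℝ) < 2 ^ n by positivity]
  have hubdd : ∀ x, BddAbove (range (u x)) := fun x => by
    refine ⟨⌈x⌉, ?_⟩
    rintro _ ⟨n, rfl⟩
    rw [div_le_iff₀ (by positivity), mul_comm, ← hFint]
    exact (Int.floor_le _).trans ((hF.2.1.iterate n).monotone (Int.le_ceil x))
  set H : ℝ → ℝ := fun x => ⨆ n, u x n with hH
  have hlim : ∀ x, Tendsto (u x) atTop (𝓝 (H x)) := fun x =>
    tendsto_atTop_ciSup (humono x) (hubdd x)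
  have hHmono : Monotone H := fun x y hxy => ciSup_mono (hubdd y) fun n => by
    have : ⌊F^[n] x⌋ ≤ ⌊F^[n] y⌋ := Int.floor_mono ((hF.2.1.iterate n).monotone hxy)
    simp only [hu]
    gcongr
  have hHF : ∀ x, H (F x) = 2 * H x := fun x => by
    refine tendsto_nhds_unique (hlim (F x)) ?_
    refine (((tendsto_add_atTop_iff_nat 1).2 (hlim x)).const_mul 2).congr fun n => ?_
    simp only [hu, Function.iterate_succ_apply, pow_succ]
    field_simp
  have hHint : ∀ k : ℤ, H k = k := fun k => by
    refine tendsto_nhds_unique (hlim k) (tendsto_const_nhds.congr fun n => ?_)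
    have : ⌊(2 ^ n * k : ℝ)⌋ = 2 ^ n * k := by exact_mod_cast Int.floor_intCast (2 ^ n * k : ℤ)
    simp only [hu, hFint, this]
    push_cast
    field_simp
  have hH1 : ∀ x, H (x + 1) = H x + 1 := fun x => by
    refine tendsto_nhds_unique (hlim (x + 1)) (((hlim x).add_const 1).congr fun n => ?_)
    have : ⌊F^[n] x + 2 ^ n⌋ = ⌊F^[n] x⌋ + 2 ^ n := by
      exact_mod_cast Int.floor_add_intCast (F^[n] x) (2 ^ n : ℤ)
    simp only [hu, hF.iterate_add_one, this]
    push_cast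
    field_simp
  have hHFn := map_iterate_of_map_eq_two_mul hHF
  have hdense : DenseRange H := by
    refine dense_of_exists_between fun a b hab => ?_
    obtain ⟨n, hn⟩ := exists_pow_lt_of_lt_one (sub_pos.2 hab) (show (1 / 2 : ℝ) < 1 by norm_num)
    have h2 : (0 : ℝ) < 2 ^ n := by positivity
    rw [one_div, inv_pow, ← one_div, div_lt_iff₀ h2] at hn
    have hk1 := Int.floor_le (a * 2 ^ n)
    have hk2 := Int.lt_floor_add_one (a * 2 ^ n)
    set k : ℤ := ⌊a * 2 ^ n⌋ + 1 with hk
    have hHk : H ((hF.iterateOrderIso n).symm k) = k / 2 ^ n := by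
      have := hHFn n ((hF.iterateOrderIso n).symm k)
      rw [← hF.iterateOrderIso_apply, OrderIso.apply_symm_apply, hHint] at this
      rw [eq_div_iff h2.ne', mul_comm]
      exact this.symm
    refine ⟨_, mem_range_self ((hF.iterateOrderIso n).symm k), ?_, ?_⟩
    · rw [hHk, lt_div_iff₀ h2, hk]
      push_cast
      exact hk2
    · rw [hHk, div_lt_iff₀ h2, hk]
      push_cast
      linarith
  exact ⟨H, hHmono.continuous_of_denseRange hdense, hHmono, hH1, hHF, hHint⟩

/-- The lift can be normalised so as to fix `0`. -/
theorem IsLiftDeg2.exists_lift_fixing_zero {φ : UnitAddCircle → UnitAddCircle} {F : ℝ → ℝ}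
    (hF : IsLiftDeg2 φ F) (h0 : φ 0 = 0) : ∃ F₀, IsLiftDeg2 φ F₀ ∧ F₀ 0 = 0 := by
  have h : ((0 : ℝ) : UnitAddCircle) = ((F 0 : ℝ) : UnitAddCircle) := by
    rw [← hF.2.2.2, AddCircle.coe_zero, h0]
  obtain ⟨c, hc⟩ := UnitAddCircle.coe_eq_coe_iff_exists_int.1 h
  refine ⟨fun x => F x - c, ⟨hF.1.sub continuous_const, fun x y hxy => ?_, fun x => ?_,
    fun x => ?_⟩, by simp [hc]⟩
  · exact sub_lt_sub_right (hF.2.1 hxy) _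
  · simp only [hF.2.2.1]
    ring
  · rw [hF.2.2.2]
    exact UnitAddCircle.coe_eq_coe_iff_exists_int.2 ⟨-c, by push_cast; ring⟩

theorem conjugateToDoubling_of_dense_iterate_preimage_zero {φ : UnitAddCircle → UnitAddCircle}
    {F : ℝ → ℝ} (hF : IsLiftDeg2 φ F) (h0 : F 0 = 0)
    (hd : Dense {y | ∃ n : ℕ, φ^[n] y = 0}) : ConjugateToDoubling φ := by
  obtain ⟨H, hcont, hmono, hH1, hHF, hHint⟩ := hF.exists_semiconj h0
  have hHFn := map_iterate_of_map_eq_two_mul hHF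
  have hbetween : ∀ x y : ℝ, x < y → ∃ a ∈ Ioo x y, ∃ (n : ℕ) (k : ℤ), F^[n] a = k := by
    intro x y hxy
    obtain ⟨_, ⟨n, hn⟩, a, ha, rfl⟩ := hd.exists_mem_open
      (QuotientAddGroup.isOpenMap_coe (Ioo x y) isOpen_Ioo) ((nonempty_Ioo.2 hxy).image _)
    have h : ((0 : ℝ) : UnitAddCircle) = ((F^[n] a : ℝ) : UnitAddCircle) := by
      rw [← hF.coe_iterate, AddCircle.coe_zero]
      exact hn.symm
    obtain ⟨k, hk⟩ := UnitAddCircle.coe_eq_coe_iff_exists_int.1 h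
    exact ⟨a, ha, n, k, by simpa using hk⟩
  have hfix : ∀ {a : ℝ} {n : ℕ} {k : ℤ}, F^[n] a = k → ∀ m, F^[m + n] a = H (F^[m + n] a) := by
    intro a n k hk m
    have hm : F^[m] (k : ℝ) = ((2 ^ m * k : ℤ) : ℝ) := by
      have := hF.iterateOrderIso_add_int m 0 k
      simpa [Function.iterate_fixed h0] using this
    rw [Function.iterate_add_apply, hk, hm, hHint]
  have hstrict : StrictMono H := by
    intro x y hxy
    obtain ⟨a, ha, n, k, hk⟩ := hbetween x y hxy
    obtain ⟨b, hb, m, l, hl⟩ := hbetween a y ha.2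
    have h1 : F^[m + n] a < F^[m + n] b := hF.2.1.iterate _ hb.1
    have h2 := hfix hl n
    rw [add_comm n m] at h2
    rw [hfix hk m, h2, hHFn, hHFn] at h1
    calc H x ≤ H a := hmono ha.1.le
      _ < H b := lt_of_mul_lt_mul_left h1 (by positivity)
      _ ≤ H y := hmono hb.2.le
  obtain ⟨h, hh⟩ := exists_homeomorph_of_lift hcont hstrict hH1
  refine ⟨h, fun x => ?_⟩
  obtain ⟨t, rfl⟩ := QuotientAddGroup.mk_surjective x
  rw [hF.2.2.2, hh, hh, hHF, doubling, ← AddCircle.coe_add, two_mul]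

/-- the action of `T_φ` on the circle is minimal (all orbits dense) if
and only if `φ` is topologically conjugate to the doubling map. -/
theorem thompson_minimal_iff_conjugate_doubling
    (φ : UnitAddCircle → UnitAddCircle) (F : ℝ → ℝ)
    (hF : IsLiftDeg2 φ F) (h0 : φ 0 = 0) :
    (∀ x : UnitAddCircle, Dense {y | ∃ g, InThompsonGroup φ F g ∧ y = g x}) ↔
      ConjugateToDoubling φ := by
  constructor
  · intro h
    obtain ⟨F₀, hF₀, hzero⟩ := hF.exists_lift_fixing_zero h0
    exact conjugateToDoubling_of_dense_iterate_preimage_zero hF₀ hzero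
      (dense_iterate_preimage_zero h0 (h 0))
  · exact fun h x => dense_orbit_of_conjugateToDoubling hF h x
end
end
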